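/- Every 6-critical graph with at most ten vertices is isomorphic to a join H_1 + H_2, where H_1 is k_1-critical, H_2 is k_2-critical, k_1 ≤ k_2, and k_1 + k_2 = 6. -/

import Mathlib

open SimpleGraph

/-- The join `K + L` of two graphs: disjoint union plus all cross edges. -/
def graphJoin {V W : Type*} (G : SimpleGraph V) (H : SimpleGraph W) :
    SimpleGraph (V ⊕ W) :=
  SimpleGraph.fromRel fun x y =>
    match x, y with
    | Sum.inl a, Sum.inl b => G.Adj a b
    | Sum.inr a, Sum.inr b => H.Adj a b
    | Sum.inl _, Sum.inr _ => True
    | Sum.inr _, Sum.inl _ => False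

/-- The cycle `C_n` on `n` vertices (vertex set `ZMod n`, `i ~ j` iff `i - j = ±1`). -/
def cyc (n : ℕ) : SimpleGraph (ZMod n) :=
  SimpleGraph.fromRel fun i j => i - j = 1

/-- The Moser spindle `H_7`: vertices `0 = z, 1 = a1, 2 = a2, 3 = b, 4 = c1, 5 = c2, 6 = d`. -/
def H7 : SimpleGraph (Fin 7) :=
  SimpleGraph.fromRel fun i j => (i.val, j.val) ∈
    [(0,1), (0,2), (1,2), (1,3), (2,3), (0,4), (0,5), (4,5), (4,6), (5,6), (3,6)]

/-- `M_7`: vertices `0..5 = x1..x6` on a 6-cycle with chords `x1x3, x3x5, x5x1`,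
and `6 = v` joined to `x2, x4, x6`. -/
def M7 : SimpleGraph (Fin 7) :=
  SimpleGraph.fromRel fun i j => (i.val, j.val) ∈
    [(0,1), (1,2), (2,3), (3,4), (4,5), (5,0), (0,2), (2,4), (4,0), (6,1), (6,3), (6,5)]

/-- `T_11`: the graph on `ZMod 11` where distinct `i, j` are adjacent iff
`i - j ≡ ±1, ±2, ±3 (mod 11)`. -/
def T11 : SimpleGraph (ZMod 11) :=
  SimpleGraph.fromRel fun i j => i - j = 1 ∨ i - j = 2 ∨ i - j = 3

/-- A graph is `t`-critical if it is not `(t-1)`-colorable but every proper subgraph is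
`(t-1)`-colorable. -/
def IsCritical (t : ℕ) {V : Type*} (G : SimpleGraph V) : Prop :=
  ¬ G.Colorable (t - 1) ∧ ∀ H : G.Subgraph, H ≠ ⊤ → H.coe.Colorable (t - 1)

/-- A coloring using at most `m` colors witnesses `m`-colorability. -/
lemma SimpleGraph.Coloring.colorable_of_card_image_le {V α : Type*} [Fintype V] [DecidableEq α]
    {G : SimpleGraph V} {m : ℕ} (c : G.Coloring α)
    (h : (Finset.univ.image c).card ≤ m) : G.Colorable m := by
  let c' : G.Coloring (Finset.univ.image c) :=
    SimpleGraph.Coloring.mk (fun v => ⟨c v, Finset.mem_image_of_mem _ (Finset.mem_univ v)⟩)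
      (fun hvw heq => c.valid hvw (congrArg Subtype.val heq))
  have := c'.colorable
  rw [Fintype.card_coe] at this
  exact this.mono h

/-- The vertices whose color class under `c` is a singleton. -/
def IsLonely {V α : Type*} (c : V → α) (x : V) : Prop := ∀ y, c y = c x → y = x

/-- Recolor `x` with the color of the lonely vertex `y`. -/
def recolor {V α : Type*} [DecidableEq V] {G : SimpleGraph V} (c : G.Coloring α) {x y : V}
    (hy : IsLonely c y) (hxy : ¬ G.Adj x y) : G.Coloring α :=
  SimpleGraph.Coloring.mk (Function.update c x (c y)) (by
    intro v w hvw heq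
    by_cases hv : v = x <;> by_cases hw : w = x
    · subst hv; subst hw; exact G.irrefl hvw
    · subst hv
      rw [Function.update_self, Function.update_of_ne hw] at heq
      exact hxy (hy w heq.symm ▸ hvw)
    · subst hw
      rw [Function.update_self, Function.update_of_ne hv] at heq
      exact hxy (hy v heq ▸ hvw.symm)
    · rw [Function.update_of_ne hv, Function.update_of_ne hw] at heq
      exact c.valid hvw heq)

lemma recolor_self {V α : Type*} [DecidableEq V] {G : SimpleGraph V} (c : G.Coloring α) {x y : V}
    (hy : IsLonely c y) (hxy : ¬ G.Adj x y) : recolor c hy hxy x = c y :=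
  Function.update_self ..

lemma recolor_of_ne {V α : Type*} [DecidableEq V] {G : SimpleGraph V} (c : G.Coloring α)
    {x y w : V} (hy : IsLonely c y) (hxy : ¬ G.Adj x y) (hw : w ≠ x) :
    recolor c hy hxy w = c w :=
  Function.update_of_ne hw ..

lemma coloring_surjective {V : Type*} [Fintype V] {G : SimpleGraph V} {n : ℕ}
    (hn : ¬ G.Colorable n) (c : G.Coloring (Fin (n + 1))) : Function.Surjective c := by
  classical
  intro i
  by_contra! hi
  refine hn (c.colorable_of_card_image_le ?_)
  have : Finset.univ.image c ⊆ Finset.univ.erase i := by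
    intro j hj
    obtain ⟨v, -, rfl⟩ := Finset.mem_image.1 hj
    simp [hi v]
  simpa using Finset.card_le_card this

/-- Two lonely vertices of an optimal coloring are adjacent. -/
lemma IsLonely.adj {V : Type*} [Fintype V] {G : SimpleGraph V} {n : ℕ}
    (hn : ¬ G.Colorable n) {c : G.Coloring (Fin (n + 1))} {x y : V} (hx : IsLonely c x)
    (hy : IsLonely c y) (hne : x ≠ y) : G.Adj x y := by
  classical
  by_contra hxy
  obtain ⟨w, hw⟩ := coloring_surjective hn (recolor c hy hxy) (c x)
  by_cases hwx : w = x
  · subst hwx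
    rw [recolor_self] at hw
    exact hne (hx y hw).symm
  · rw [recolor_of_ne _ _ _ hwx] at hw
    exact hwx (hx w hw)

open Classical in
/-- The number of lonely vertices of a coloring. -/
noncomputable def lonelyCount {V α : Type*} [Fintype V] (c : V → α) : ℕ :=
  (Finset.univ.filter (IsLonely c)).card

/-- If `c` has as few lonely vertices as possible, `y` is lonely and `x` is a non-neighbor of `y`,
then the class of `x` is a pair `{x, z}`, and moving `x` to the class of `y` makes `z` lonely
without changing the number of lonely vertices. -/
lemma exists_partner {V : Type*} [Fintype V] [DecidableEq V] {G : SimpleGraph V} {n : ℕ}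
    (hn : ¬ G.Colorable n) {c : G.Coloring (Fin (n + 1))}
    (hmin : ∀ d : G.Coloring (Fin (n + 1)), lonelyCount c ≤ lonelyCount d)
    {x y : V} (hy : IsLonely c y) (hxy : ¬ G.Adj x y) (hne : x ≠ y) :
    ∃ z, z ≠ x ∧ c z = c x ∧ (∀ w, c w = c x → w = x ∨ w = z) ∧
      IsLonely (recolor c hy hxy) z ∧ lonelyCount (recolor c hy hxy) ≤ lonelyCount c := by
  classical
  have hcxy : c x ≠ c y := fun h => hne (hy x h)
  have hx : ¬ IsLonely c x := fun hx => hxy (hx.adj hn hy hne)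
  have hx' := hx
  unfold IsLonely at hx'
  push Not at hx'
  obtain ⟨z, hz, hzx⟩ := hx'
  set c' := recolor c hy hxy with hc'
  have h1 : c' x = c y := recolor_self ..
  have h2 : ∀ w, w ≠ x → c' w = c w := fun w hw => recolor_of_ne _ _ _ hw
  have hyl : ¬ IsLonely c' y := by
    intro h
    exact hne (h x (by rw [h1, h2 y hne.symm]))
  have hxl : ¬ IsLonely c' x := by
    intro h
    exact hne (h y (by rw [h1, h2 y hne.symm])).symm
  have hpair : ∀ w, c w = c x → w = x ∨ w = z := by
    intro w hw
    by_contra! hwn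
    obtain ⟨hwx, hwz⟩ := hwn
    have hsub : Finset.univ.filter (IsLonely c') ⊆ (Finset.univ.filter (IsLonely c)).erase y := by
      intro a ha
      simp only [Finset.mem_filter, Finset.mem_univ, true_and, Finset.mem_erase] at ha ⊢
      have hay : a ≠ y := fun h => hyl (h ▸ ha)
      have hax : a ≠ x := fun h => hxl (h ▸ ha)
      refine ⟨hay, fun b hb => ?_⟩
      by_cases hbx : b = x
      · subst hbx
        have e1 := ha w (by rw [h2 w hwx, h2 a hax, hw, hb])
        have e2 := ha z (by rw [h2 z hzx, h2 a hax, hz, hb])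
        exact absurd (e1.trans e2.symm) hwz
      · exact ha b (by rw [h2 b hbx, h2 a hax, hb])
    have h3 := Finset.card_le_card hsub
    have h4 := Finset.card_erase_lt_of_mem
      (s := Finset.univ.filter (IsLonely c)) (a := y) (by simpa using hy)
    have h5 := hmin c'
    unfold lonelyCount at h5
    omega
  refine ⟨z, hzx, hz, hpair, ?_, ?_⟩
  · intro w hw
    by_cases hwx : w = x
    · subst hwx
      rw [h1, h2 z hzx, hz] at hw
      exact absurd hw.symm hcxy
    · rw [h2 w hwx, h2 z hzx, hz] at hw
      exact (hpair w hw).resolve_left hwx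
  · have hsub : Finset.univ.filter (IsLonely c') ⊆
        insert z ((Finset.univ.filter (IsLonely c)).erase y) := by
      intro a ha
      simp only [Finset.mem_filter, Finset.mem_univ, true_and, Finset.mem_erase,
        Finset.mem_insert] at ha ⊢
      have hay : a ≠ y := fun h => hyl (h ▸ ha)
      have hax : a ≠ x := fun h => hxl (h ▸ ha)
      by_cases haz : a = z
      · exact Or.inl haz
      · refine Or.inr ⟨hay, fun b hb => ?_⟩
        by_cases hbx : b = x
        · subst hbx
          rcases hpair a hb.symm with h | h
          · exact absurd h hax
          · exact absurd h haz
        · exact ha b (by rw [h2 b hbx, h2 a hax, hb])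
    have h3 := Finset.card_le_card hsub
    have h4 := Finset.card_erase_lt_of_mem
      (s := Finset.univ.filter (IsLonely c)) (a := y) (by simpa using hy)
    have h5 := Finset.card_insert_le z ((Finset.univ.filter (IsLonely c)).erase y)
    unfold lonelyCount
    omega

/-- The coloring that uses `M` inside `S` and `N`, with a disjoint set of colors, outside `S`. -/
def glue {V α β : Type*} {G : SimpleGraph V} (M : G.Coloring α) (N : G.Coloring β)
    (S : Set V) [DecidablePred (· ∈ S)] : G.Coloring (α ⊕ β) :=
  SimpleGraph.Coloring.mk (fun w => if w ∈ S then Sum.inl (M w) else Sum.inr (N w)) (by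
    intro v w hvw heq
    by_cases hv : v ∈ S <;> by_cases hw : w ∈ S <;> simp only [hv, hw, if_true, if_false,
      Sum.inl.injEq, Sum.inr.injEq, reduceCtorEq] at heq
    · exact M.valid hvw heq
    · exact N.valid hvw heq)

lemma card_image_glue_le {V α β : Type*} [Fintype V] [Fintype β] [DecidableEq α] [DecidableEq β]
    {G : SimpleGraph V} (M : G.Coloring α) (N : G.Coloring β)
    (S : Set V) [DecidablePred (· ∈ S)] (P : Finset α) (Q : Finset β)
    (hP : ∀ w ∈ S, M w ∈ P) (hQ : ∀ w, w ∉ S → N w ∉ Q) :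
    (Finset.univ.image (glue M N S)).card ≤ P.card + (Fintype.card β - Q.card) := by
  rw [← Finset.card_compl, ← Finset.card_disjSum]
  refine Finset.card_le_card fun i hi => ?_
  obtain ⟨w, -, rfl⟩ := Finset.mem_image.1 hi
  change (if w ∈ S then Sum.inl (M w) else Sum.inr (N w)) ∈ _
  split_ifs with hw
  · simpa using hP w hw
  · simpa using hQ w hw

/-- Let `M` have as few lonely vertices as possible, with `u` and `v` lonely. If `t` is a
non-neighbor of `u` that is lonely in some coloring, then `t` and `v` are lonely in a coloring
which also has as few lonely vertices as possible. -/
lemma lonely_transfer {V : Type*} [Fintype V] {G : SimpleGraph V} {n : ℕ}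
    (hn : ¬ G.Colorable n) {M N : G.Coloring (Fin (n + 1))}
    (hmin : ∀ d : G.Coloring (Fin (n + 1)), lonelyCount M ≤ lonelyCount d)
    {u v t : V} (hu : IsLonely M u) (hv : IsLonely M v) (huv : u ≠ v)
    (ht : IsLonely N t) (htu : ¬ G.Adj t u) (hne : t ≠ u) :
    ∃ M' : G.Coloring (Fin (n + 1)), lonelyCount M' ≤ lonelyCount M ∧
      IsLonely M' t ∧ IsLonely M' v ∧ t ≠ v := by
  classical
  let good : Finset V → Prop := fun Y =>
    u ∈ Y ∧ (∀ x, x ∉ Y → M x ∈ Y.image M → ∃ y ∈ Y, N x = N y) ∧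
    ∀ y ∈ Y, ∃ M' : G.Coloring (Fin (n + 1)), lonelyCount M' ≤ lonelyCount M ∧
      IsLonely M' y ∧ IsLonely M' v ∧ y ≠ v ∧
      ∀ w, (M' w = M w ∧ M w ∉ Y.image M) ∨ (M' w ∈ Y.image M ∧ M w ∈ Y.image M)
  have hgood : good {u} := by
    refine ⟨by simp, fun x hx hxM => ?_, fun y hy => ?_⟩
    · simp only [Finset.image_singleton, Finset.mem_singleton] at hx hxM
      exact absurd (hu x hxM) hx
    · obtain rfl := Finset.mem_singleton.1 hy
      refine ⟨M, le_rfl, hu, hv, huv, fun w => ?_⟩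
      tauto
  obtain ⟨Y, hY, hYmax⟩ := (Finset.univ.filter good).exists_max_image Finset.card
    ⟨{u}, by simpa using hgood⟩
  simp only [Finset.mem_filter, Finset.mem_univ, true_and] at hY hYmax
  obtain ⟨huY, hYN, hYM⟩ := hY
  have hclosed : ∀ x, N x ∈ Y.image N → M x ∈ Y.image M := by
    intro x hx
    by_contra hxM
    obtain ⟨y, hyY, hyx⟩ := Finset.mem_image.1 hx
    obtain ⟨M', hM', hy, hv', hyv, hag⟩ := hYM y hyY
    have hxy : x ≠ y := by
      rintro rfl
      exact hxM (Finset.mem_image_of_mem _ hyY)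
    have hadj : ¬ G.Adj x y := fun h => N.valid h hyx.symm
    have hmin' : ∀ d : G.Coloring (Fin (n + 1)), lonelyCount M' ≤ lonelyCount d :=
      fun d => hM'.trans (hmin d)
    obtain ⟨z, hzx, hz, hpair, hzl, hcount⟩ := exists_partner hn hmin' hy hadj hxy
    have hx' : M' x = M x := by
      rcases hag x with h | h
      · exact h.1
      · exact absurd h.2 hxM
    have hz' : M' z = M z ∧ M z ∉ Y.image M := by
      rcases hag z with h | h
      · exact h
      · rw [hz, hx'] at h
        exact absurd h.1 hxM
    have hzM : M z = M x := by rw [← hz'.1, hz, hx']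
    have hzY : z ∉ Y := fun h => hz'.2 (Finset.mem_image_of_mem _ h)
    have hvx : v ≠ x := by
      rintro rfl
      exact hzx (hv z hzM)
    have hvz : v ≠ z := by
      rintro rfl
      exact hzx (hv x hzM.symm).symm
    have himg : (insert z Y).image M = insert (M z) (Y.image M) := Finset.image_insert ..
    have key : good (insert z Y) := by
      refine ⟨Finset.mem_insert_of_mem huY, fun w hw hwM => ?_, fun w hw => ?_⟩
      · rw [himg, Finset.mem_insert] at hwM
        rw [Finset.mem_insert, not_or] at hw
        rcases hwM with h | h
        · have hwx : w = x := by
            have hw2 : M' w = M' x := by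
              rcases hag w with h' | h'
              · rw [h'.1, h, hzM, hx']
              · rw [h] at h'
                exact absurd h'.2 hz'.2
            exact (hpair w hw2).resolve_right hw.1
          exact ⟨y, Finset.mem_insert_of_mem hyY, hwx ▸ hyx.symm⟩
        · obtain ⟨a, ha, hwa⟩ := hYN w hw.2 h
          exact ⟨a, Finset.mem_insert_of_mem ha, hwa⟩
      · rw [himg]
        rcases Finset.mem_insert.1 hw with rfl | hw
        · refine ⟨recolor M' hy hadj, hcount.trans hM', hzl, ?_, hvz.symm, fun a => ?_⟩
          · intro b hb
            rw [recolor_of_ne _ _ _ hvx] at hb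
            by_cases hbx : b = x
            · subst hbx
              rw [recolor_self] at hb
              exact absurd (hv' y hb) hyv
            · rw [recolor_of_ne _ _ _ hbx] at hb
              exact hv' b hb
          · by_cases hax : a = x
            · subst hax
              right
              rw [recolor_self, ← hzM]
              refine ⟨Finset.mem_insert_of_mem ?_, Finset.mem_insert_self ..⟩
              rcases hag y with h | h
              · exact absurd (Finset.mem_image_of_mem _ hyY) h.2
              · exact h.1
            · rw [recolor_of_ne _ _ _ hax]
              simp only [Finset.mem_insert]
              rcases hag a with h | h
              · by_cases haz : M a = M w
                · right
                  rw [h.1]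
                  exact ⟨Or.inl haz, Or.inl haz⟩
                · left
                  exact ⟨h.1, by tauto⟩
              · right
                tauto
        · obtain ⟨K, h1, h2, h3, h4, h5⟩ := hYM w hw
          refine ⟨K, h1, h2, h3, h4, fun a => ?_⟩
          simp only [Finset.mem_insert]
          rcases h5 a with h | h
          · by_cases haz : M a = M z
            · right
              rw [h.1]
              exact ⟨Or.inl haz, Or.inl haz⟩
            · left
              exact ⟨h.1, by tauto⟩
          · right
            tauto
    have := hYmax _ key
    rw [Finset.card_insert_of_notMem hzY] at this
    omega
  have hiff : ∀ x, M x ∈ Y.image M → N x ∈ Y.image N := by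
    intro x hx
    by_cases hxY : x ∈ Y
    · exact Finset.mem_image_of_mem _ hxY
    · obtain ⟨y, hy, h⟩ := hYN x hxY hx
      exact h ▸ Finset.mem_image_of_mem _ hy
  let S : Set V := {x | M x ∈ Y.image M}
  have hcQ : (Y.image N).card ≤ n + 1 := by
    simpa using Finset.card_le_univ (Y.image N)
  have hcP : (Y.image M).card ≤ n + 1 := by
    simpa using Finset.card_le_univ (Y.image M)
  have hle : (Y.image M).card ≤ (Y.image N).card := by
    by_contra! hlt
    refine hn ((glue N M S).colorable_of_card_image_le ?_)
    have := card_image_glue_le N M S (Y.image N) (Y.image M) (fun w hw => hiff w hw)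
      (fun w hw => hw)
    rw [Fintype.card_fin] at this
    omega
  have htS : M t ∈ Y.image M := by
    by_contra htS
    have htQ : N t ∉ Y.image N := fun h => htS (hclosed t h)
    have huS : u ∈ S := Finset.mem_image_of_mem _ huY
    let K := glue M N S
    have hKu : K u = Sum.inl (M u) := if_pos huS
    have hKlonely : IsLonely K u := by
      intro w hw
      rw [hKu] at hw
      by_cases hwS : w ∈ S
      · have : K w = Sum.inl (M w) := if_pos hwS
        rw [this] at hw
        exact hu w (Sum.inl.inj hw)
      · have : K w = Sum.inr (N w) := if_neg hwS
        rw [this] at hw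
        cases hw
    refine hn ((recolor K hKlonely htu).colorable_of_card_image_le ?_)
    have hsub : Finset.univ.image (recolor K hKlonely htu) ⊆
        (Y.image M).disjSum (insert (N t) (Y.image N))ᶜ := by
      intro i hi
      obtain ⟨w, -, rfl⟩ := Finset.mem_image.1 hi
      by_cases hwt : w = t
      · subst hwt
        rw [recolor_self, hKu]
        simpa using ⟨u, huY, rfl⟩
      · rw [recolor_of_ne _ _ _ hwt]
        by_cases hwS : w ∈ S
        · have : K w = Sum.inl (M w) := if_pos hwS
          rw [this, Finset.inl_mem_disjSum]
          exact hwS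
        · have : K w = Sum.inr (N w) := if_neg hwS
          rw [this, Finset.inr_mem_disjSum, Finset.mem_compl, Finset.mem_insert, not_or]
          exact ⟨fun h => hwt (ht w h), fun h => hwS (hclosed w h)⟩
    have h1 := Finset.card_le_card hsub
    rw [Finset.card_disjSum, Finset.card_compl, Fintype.card_fin,
      Finset.card_insert_of_notMem htQ] at h1
    have hlt : (Y.image N).card + 1 ≤ n + 1 := by
      rw [← Finset.card_insert_of_notMem htQ]
      simpa using Finset.card_le_univ (insert (N t) (Y.image N))
    omega
  have htY : t ∈ Y := by
    by_contra htY
    obtain ⟨y, hy, h⟩ := hYN t htY htS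
    exact htY (ht y h.symm ▸ hy)
  obtain ⟨L, h1, h2, h3, h4, -⟩ := hYM t htY
  exact ⟨L, h1, h2, h3, h4⟩

/-- **Gallai's theorem**: a vertex-critical graph with chromatic number `n + 1` and at most `2 * n`
vertices has a disconnected complement. -/
theorem exists_join_partition {V : Type*} [Fintype V] {G : SimpleGraph V} {n : ℕ}
    (hn : ¬ G.Colorable n) (hcrit : ∀ t, ∃ c : G.Coloring (Fin (n + 1)), IsLonely c t)
    (hcard : Fintype.card V ≤ 2 * n) :
    ∃ W : Set V, W.Nonempty ∧ Wᶜ.Nonempty ∧ ∀ x ∈ W, ∀ y ∉ W, G.Adj x y := by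
  classical
  have hV : Nonempty V := by
    by_contra h
    rw [not_nonempty_iff] at h
    exact hn ⟨SimpleGraph.Coloring.mk (fun v => isEmptyElim v) (fun {v} => isEmptyElim v)⟩
  have : Nonempty (G.Coloring (Fin (n + 1))) := ⟨(hcrit hV.some).choose⟩
  obtain ⟨M, hM⟩ : ∃ M : G.Coloring (Fin (n + 1)),
      ∀ d : G.Coloring (Fin (n + 1)), lonelyCount M ≤ lonelyCount d :=
    ⟨Function.argmin (fun c : G.Coloring (Fin (n + 1)) => lonelyCount c),
      fun d => Function.argmin_le (fun c : G.Coloring (Fin (n + 1)) => lonelyCount c) d⟩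
  have hsurj := coloring_surjective hn M
  have htwo : 1 < lonelyCount M := by
    by_contra! hle
    have h1 : ∀ i : Fin (n + 1), 2 ≤ (Finset.univ.filter (fun v => M v = i)).card +
        ((Finset.univ.filter (IsLonely M)).filter (fun v => M v = i)).card := by
      intro i
      obtain ⟨v, rfl⟩ := hsurj i
      by_cases hv : IsLonely M v
      · have a1 : 0 < (Finset.univ.filter (fun w => M w = M v)).card :=
          Finset.card_pos.2 ⟨v, by simp⟩
        have a2 : 0 < ((Finset.univ.filter (IsLonely M)).filter (fun w => M w = M v)).card :=
          Finset.card_pos.2 ⟨v, by simpa using hv⟩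
        omega
      · unfold IsLonely at hv
        push Not at hv
        obtain ⟨w, hw, hwv⟩ := hv
        have : 1 < (Finset.univ.filter (fun w => M w = M v)).card :=
          Finset.one_lt_card.2 ⟨w, by simpa using hw, v, by simp, hwv⟩
        omega
    have h2 := Finset.sum_le_sum (s := Finset.univ) (fun i _ => h1 i)
    rw [Finset.sum_add_distrib, ← Finset.card_eq_sum_card_fiberwise (fun _ _ => by simp),
      ← Finset.card_eq_sum_card_fiberwise (fun _ _ => by simp)] at h2
    unfold lonelyCount at hle
    simp only [Finset.sum_const, Finset.card_univ, Fintype.card_fin, smul_eq_mul] at h2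
    omega
  obtain ⟨u, hu, v, hv, huv⟩ := Finset.one_lt_card.1 htwo
  simp only [Finset.mem_filter, Finset.mem_univ, true_and] at hu hv
  refine ⟨{w | ∃ M' : G.Coloring (Fin (n + 1)), lonelyCount M' ≤ lonelyCount M ∧
    IsLonely M' w ∧ IsLonely M' v ∧ w ≠ v}, ⟨u, M, le_rfl, hu, hv, huv⟩,
    ⟨v, fun ⟨_, _, _, _, h⟩ => h rfl⟩, ?_⟩
  rintro x ⟨M', hM', hx, hv', hxv⟩ y hy
  by_contra hadj
  obtain ⟨N, hN⟩ := hcrit y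
  have hyx : y ≠ x := by
    rintro rfl
    exact hy ⟨M', hM', hx, hv', hxv⟩
  obtain ⟨K, h1, h2, h3, h4⟩ := lonely_transfer hn (fun d => hM'.trans (hM d)) hx hv' hxv hN
    (fun h => hadj h.symm) hyx
  exact hy ⟨K, le_trans h1 hM', h2, h3, h4⟩

/-- Extend a subgraph of `G.induce W` by all
vertices outside `W` and all edges of `G` not inside `W`. -/
def extendSubgraph {V : Type*} {G : SimpleGraph V} {W : Set V} (H : (G.induce W).Subgraph) :
    G.Subgraph where
  verts := {x | ∀ hx : x ∈ W, (⟨x, hx⟩ : W) ∈ H.verts}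
  Adj x y := G.Adj x y ∧ (∀ hx : x ∈ W, ⟨x, hx⟩ ∈ H.verts) ∧ (∀ hy : y ∈ W, ⟨y, hy⟩ ∈ H.verts) ∧
    ∀ (hx : x ∈ W) (hy : y ∈ W), H.Adj ⟨x, hx⟩ ⟨y, hy⟩
  adj_sub h := h.1
  edge_vert {_ _} h hx := h.2.1 hx
  symm := ⟨fun _ _ h => ⟨h.1.symm, h.2.2.1, h.2.1, fun hx hy => (h.2.2.2 hy hx).symm⟩⟩

lemma extendSubgraph_ne_top {V : Type*} {G : SimpleGraph V} {W : Set V}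
    {H : (G.induce W).Subgraph} (hH : H ≠ ⊤) : extendSubgraph H ≠ ⊤ := by
  intro h
  refine hH (Subgraph.ext ?_ ?_)
  · ext ⟨x, hx⟩
    have : x ∈ (extendSubgraph H).verts := by simp [h]
    simpa using this hx
  · ext ⟨x, hx⟩ ⟨y, hy⟩
    refine ⟨fun h => H.adj_sub h, fun hxy => ?_⟩
    have : (extendSubgraph H).Adj x y := by
      rw [h]
      exact hxy
    exact this.2.2.2 hx hy

/-- In a colored graph all of whose vertices map to `A` or to `B`, where everything in the image of
`A` is adjacent to everything in the image of `B`, the colors split between `A` and `B`. -/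
lemma colorable_split {V A B : Type*} [Finite A] [Finite B] {K : SimpleGraph V} {m : ℕ}
    {GA : SimpleGraph A} {GB : SimpleGraph B} (hK : K.Colorable m) (f : GA →g K) (g : GB →g K)
    (hfg : ∀ a b, K.Adj (f a) (g b)) :
    ∃ p q, p + q ≤ m ∧ GA.Colorable p ∧ GB.Colorable q := by
  classical
  have := Fintype.ofFinite A
  have := Fintype.ofFinite B
  obtain ⟨c⟩ := hK
  refine ⟨_, _, ?_, SimpleGraph.Coloring.colorable_of_card_image_le (c.comp f) le_rfl,
    SimpleGraph.Coloring.colorable_of_card_image_le (c.comp g) le_rfl⟩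
  rw [← Finset.card_union_of_disjoint]
  · simpa using Finset.card_le_univ (_ : Finset (Fin m))
  · rw [Finset.disjoint_left]
    intro i hi hj
    obtain ⟨a, -, rfl⟩ := Finset.mem_image.1 hi
    obtain ⟨b, -, hb⟩ := Finset.mem_image.1 hj
    exact c.valid (hfg a b) hb.symm

lemma colorable_of_induce {V : Type*} {G : SimpleGraph V} (W : Set V) {p q : ℕ}
    (hp : (G.induce W).Colorable p) (hq : (G.induce Wᶜ).Colorable q) : G.Colorable (p + q) := by
  classical
  obtain ⟨c⟩ := hp
  obtain ⟨d⟩ := hq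
  have e : G.Coloring (Fin p ⊕ Fin q) := SimpleGraph.Coloring.mk
    (fun x => if hx : x ∈ W then Sum.inl (c ⟨x, hx⟩) else Sum.inr (d ⟨x, hx⟩)) (by
      intro x y hxy heq
      by_cases hx : x ∈ W <;> by_cases hy : y ∈ W <;> simp only [hx, hy, dif_pos, dif_neg,
        Sum.inl.injEq, Sum.inr.injEq, reduceCtorEq, not_false_eq_true] at heq
      · exact c.valid (v := ⟨x, hx⟩) (w := ⟨y, hy⟩) hxy heq
      · exact d.valid (v := ⟨x, hx⟩) (w := ⟨y, hy⟩) hxy heq)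
  simpa using e.colorable

/-- If `G` is critical and a join of two parts, then each part is critical. -/
lemma IsCritical.induce {V : Type*} [Finite V] {G : SimpleGraph V} {n k l : ℕ}
    (hG : IsCritical (n + 1) G) {W : Set V} (hW : ∀ x ∈ W, ∀ y ∉ W, G.Adj x y)
    (hk : ¬ (G.induce W).Colorable (k - 1)) (hl : ¬ (G.induce Wᶜ).Colorable (l - 1))
    (hl0 : 0 < l) (hkl : n + 1 ≤ k + l) : IsCritical k (G.induce W) := by
  refine ⟨hk, fun H hH => ?_⟩
  have hcol := hG.2 (extendSubgraph H) (extendSubgraph_ne_top hH)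
  let f : H.coe →g (extendSubgraph H).coe :=
    { toFun := fun a => ⟨a.1.1, fun _ => a.2⟩
      map_rel' := fun {a b} hab => ⟨H.adj_sub hab, fun _ => a.2, fun _ => b.2, fun _ _ => hab⟩ }
  let g : G.induce Wᶜ →g (extendSubgraph H).coe :=
    { toFun := fun a => ⟨a.1, fun ha => absurd ha a.2⟩
      map_rel' := fun {a b} hab => ⟨hab, fun ha => absurd ha a.2, fun hb => absurd hb b.2,
        fun ha => absurd ha a.2⟩ }
  obtain ⟨p, q, hpq, hp, hq⟩ := colorable_split hcol f g fun a b =>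
    ⟨hW a.1.1 a.1.2 b.1 b.2, fun _ => a.2, fun hb => absurd hb b.2, fun _ hb => absurd hb b.2⟩
  have hlq : l ≤ q := by
    by_contra! h
    exact hl (hq.mono (by omega))
  exact hp.mono (by omega)

/-- A critical graph has, for each vertex, a coloring with one extra color used only there. -/
lemma IsCritical.exists_lonely {V : Type*} {G : SimpleGraph V} {n : ℕ}
    (hG : IsCritical (n + 1) G) (t : V) : ∃ c : G.Coloring (Fin (n + 1)), IsLonely c t := by
  classical
  obtain ⟨c⟩ := hG.2 ((⊤ : G.Subgraph).deleteVerts {t}) (by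
    intro h
    have : t ∈ ((⊤ : G.Subgraph).deleteVerts {t}).verts := by simp [h]
    simp at this)
  have hmem : ∀ {x}, x ≠ t → x ∈ ((⊤ : G.Subgraph).deleteVerts {t}).verts := by
    intro x hx
    simpa using hx
  let F : V → Fin (n + 1) := fun x => if hx : x = t then Fin.last n else (c ⟨x, hmem hx⟩).castSucc
  have hFt : F t = Fin.last n := dif_pos rfl
  have hF : ∀ x (hx : x ≠ t), F x = (c ⟨x, hmem hx⟩).castSucc := fun x hx => dif_neg hx
  have hlonely : IsLonely F t := by
    intro y hy
    by_contra hyt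
    rw [hFt, hF y hyt] at hy
    exact (Fin.castSucc_lt_last _).ne hy
  refine ⟨SimpleGraph.Coloring.mk F ?_, hlonely⟩
  intro x y hxy heq
  by_cases hx : x = t
  · subst hx
    exact hxy.ne (hlonely y heq.symm).symm
  · by_cases hy : y = t
    · subst hy
      exact hxy.ne (hlonely x heq)
    · rw [hF x hx, hF y hy] at heq
      refine c.valid (v := ⟨x, hmem hx⟩) (w := ⟨y, hmem hy⟩) ?_ (Fin.castSucc_injective n heq)
      simpa [hx, hy] using hxy

lemma graphJoin_adj_inl {V W : Type*} {G : SimpleGraph V} {H : SimpleGraph W} {a b : V} :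
    (graphJoin G H).Adj (Sum.inl a) (Sum.inl b) ↔ G.Adj a b := by
  simp only [graphJoin, fromRel_adj, ne_eq, Sum.inl.injEq]
  exact ⟨fun h => h.2.elim id fun h => h.symm, fun h => ⟨h.ne, Or.inl h⟩⟩

lemma graphJoin_adj_inr {V W : Type*} {G : SimpleGraph V} {H : SimpleGraph W} {a b : W} :
    (graphJoin G H).Adj (Sum.inr a) (Sum.inr b) ↔ H.Adj a b := by
  simp only [graphJoin, fromRel_adj, ne_eq, Sum.inr.injEq]
  exact ⟨fun h => h.2.elim id fun h => h.symm, fun h => ⟨h.ne, Or.inl h⟩⟩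

lemma graphJoin_adj_inl_inr {V W : Type*} {G : SimpleGraph V} {H : SimpleGraph W} {a : V} {b : W} :
    (graphJoin G H).Adj (Sum.inl a) (Sum.inr b) := by
  simp [graphJoin]

/-- A graph in which every vertex of `W` is adjacent to every vertex outside `W` is a join. -/
lemma nonempty_iso_graphJoin {V : Type*} {G : SimpleGraph V} {W : Set V}
    (hW : ∀ x ∈ W, ∀ y ∉ W, G.Adj x y) :
    Nonempty (G ≃g graphJoin (G.induce W) (G.induce Wᶜ)) := by
  classical
  refine ⟨RelIso.symm ⟨Equiv.Set.sumCompl W, ?_⟩⟩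
  rintro (⟨a, ha⟩ | ⟨a, ha⟩) (⟨b, hb⟩ | ⟨b, hb⟩)
  · simp [graphJoin_adj_inl]
  · simpa [graphJoin_adj_inl_inr] using hW a ha b hb
  · simpa [(graphJoin_adj_inl_inr.symm : (graphJoin (G.induce W) (G.induce Wᶜ)).Adj
      (Sum.inr ⟨a, ha⟩) (Sum.inl ⟨b, hb⟩))] using (hW b hb a ha).symm
  · simp [graphJoin_adj_inr]

lemma exists_not_colorable_pred {V : Type*} [Finite V] [Nonempty V] (G : SimpleGraph V) :
    ∃ k, 0 < k ∧ G.Colorable k ∧ ¬ G.Colorable (k - 1) := by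
  classical
  have := Fintype.ofFinite V
  have hex : ∃ k, G.Colorable k := ⟨_, G.selfColoring.colorable⟩
  have h0 : ¬ G.Colorable 0 := by
    rintro ⟨c⟩
    exact (c (Classical.arbitrary V)).elim0
  have hpos : 0 < Nat.find hex := by
    rw [Nat.find_pos]
    exact h0
  exact ⟨Nat.find hex, hpos, Nat.find_spec hex, Nat.find_min hex (Nat.sub_lt hpos one_pos)⟩

/-- An `(n + 1)`-critical graph on at most `2 * n` vertices is a join of two critical graphs. -/
theorem IsCritical.exists_join {V : Type*} [Fintype V] {G : SimpleGraph V} {n : ℕ}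
    (hG : IsCritical (n + 1) G) (hcard : Fintype.card V ≤ 2 * n) :
    ∃ (k₁ k₂ : ℕ) (W : Set V), IsCritical k₁ (G.induce W) ∧ IsCritical k₂ (G.induce Wᶜ) ∧
      k₁ ≤ k₂ ∧ k₁ + k₂ = n + 1 ∧ ∀ x ∈ W, ∀ y ∉ W, G.Adj x y := by
  obtain ⟨W, hne, hne', hW⟩ := exists_join_partition hG.1 hG.exists_lonely hcard
  have := hne.to_subtype
  have := hne'.to_subtype
  obtain ⟨k, hk0, hk, hk'⟩ := exists_not_colorable_pred (G.induce W)
  obtain ⟨l, hl0, hl, hl'⟩ := exists_not_colorable_pred (G.induce Wᶜ)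
  have hle : n + 1 ≤ k + l := by
    by_contra! h
    exact hG.1 ((colorable_of_induce W hk hl).mono (by omega))
  have hge : k + l ≤ n + 1 := by
    obtain ⟨c, -⟩ := hG.exists_lonely hne.some
    obtain ⟨p, q, hpq, hp, hq⟩ := colorable_split ⟨c⟩ (Embedding.induce W).toHom
      (Embedding.induce Wᶜ).toHom fun a b => hW a a.2 b b.2
    have hkp : k ≤ p := by
      by_contra! h
      exact hk' (hp.mono (by omega))
    have hlq : l ≤ q := by
      by_contra! h
      exact hl' (hq.mono (by omega))
    omega
  have hWc : ∀ x ∈ Wᶜ, ∀ y ∉ Wᶜ, G.Adj x y := fun x hx y hy => (hW y (not_not.1 hy) x hx).symm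
  have h1 := hG.induce hW hk' hl' hl0 hle
  have h2 := hG.induce hWc hl' (by rwa [compl_compl]) hk0 (by omega)
  rcases le_total k l with h | h
  · exact ⟨k, l, W, h1, h2, h, by omega, hW⟩
  · exact ⟨l, k, Wᶜ, h2, by rwa [compl_compl], h, by omega, hWc⟩

/-- Every 6-critical graph with at most ten vertices is isomorphic to a join
`H_1 + H_2` where `H_i` is `k_i`-critical, `k_1 ≤ k_2` and `k_1 + k_2 = 6`. -/
theorem six_critical_at_most_ten_vertices_is_join {V : Type} [Fintype V]
    (G : SimpleGraph V) (hG : IsCritical 6 G) (hcard : Fintype.card V ≤ 10) :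
    ∃ (k₁ k₂ : ℕ) (V₁ V₂ : Type) (H₁ : SimpleGraph V₁) (H₂ : SimpleGraph V₂),
      IsCritical k₁ H₁ ∧ IsCritical k₂ H₂ ∧ k₁ ≤ k₂ ∧ k₁ + k₂ = 6 ∧
      Nonempty (G ≃g graphJoin H₁ H₂) := by
  obtain ⟨k₁, k₂, W, h1, h2, hle, hsum, hW⟩ := hG.exists_join hcard
  exact ⟨k₁, k₂, _, _, _, _, h1, h2, hle, hsum, nonempty_iso_graphJoin hW⟩
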